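/- Let G̃ be a finite connected d-regular simple graph on b vertices with d ≥ 2, let A be a finite field, and let α ≥ 1 be an integer. Then the Construction-1 sum-network built from G̃ with bottleneck capacity α has capacity 2α/(2+d): there exists a Construction-1 (αb, b(2+d)/2)-code of capacity α (note b(2+d)/2 = |Ṽ|+|Ẽ| is an integer since |Ẽ| = db/2), and every Construction-1 (r,l)-code of capacity α satisfies r·(2+d) ≤ 2·l·α. -/

import Mathlib

/-- Source index set for Construction 1: one source per vertex and one per edge. -/
abbrev Src1 {V : Type} (G : SimpleGraph V) : Type := V ⊕ ↥G.edgeSet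

/-- The set `A_i` of sources connected to the tail of bottleneck edge `e_i` in
Construction 1: the vertex source `i` and the edge sources of edges incident to `i`. -/
def A1 {V : Type} (G : SimpleGraph V) (i : V) : Set (Src1 G) :=
  fun s => match s with
  | Sum.inl j => j = i
  | Sum.inr e => i ∈ (e : Sym2 V)

/-- A Construction-1 `(r,l)`-code of capacity `α` over the finite field `A`:
encoding functions `φ i` on each bottleneck edge (depending only on the sources in `A_i`),
such that (i) each vertex-terminal `t_i`, (ii) each edge-terminal `t_e`, and
(iii) the starred terminal `t_⋆` can decode the sum of all sources. -/
def IsCode1 {V : Type} [Fintype V] [DecidableEq V] (G : SimpleGraph V)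
    [DecidableRel G.Adj] (A : Type) [Field A] [Fintype A] (r l α : ℕ)
    (φ : ∀ i : V, (↥(A1 G i) → (Fin r → A)) → (Fin (α * l) → A)) : Prop :=
  (∀ i : V,
    ∃ ψ : (Fin (α * l) → A) → (↥((A1 G i)ᶜ) → (Fin r → A)) → (Fin r → A),
      ∀ x : Src1 G → (Fin r → A),
        ψ (φ i (fun a => x a.1)) (fun a => x a.1) = ∑ s, x s) ∧
  (∀ i j : V, G.Adj i j →
    ∃ ψ : (Fin (α * l) → A) → (Fin (α * l) → A) →
        (↥((A1 G i ∪ A1 G j)ᶜ) → (Fin r → A)) → (Fin r → A),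
      ∀ x : Src1 G → (Fin r → A),
        ψ (φ i (fun a => x a.1)) (φ j (fun a => x a.1)) (fun a => x a.1) = ∑ s, x s) ∧
  (∃ ψ : (V → (Fin (α * l) → A)) → (Fin r → A),
      ∀ x : Src1 G → (Fin r → A),
        ψ (fun i => φ i (fun a => x a.1)) = ∑ s, x s)

/-- A feasible CODE-FEAS-1 assignment: nonnegative integers `m e i` for each edge `e` and
endpoint `i` of `e` with `m e i + m e j = |Ṽ|` for every edge `e = {i,j}` and
`∑_{e ∋ i} m e i ≤ |Ẽ|` for every vertex `i`. -/
def Feas1 {V : Type} [Fintype V] [DecidableEq V] (G : SimpleGraph V)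
    [DecidableRel G.Adj] (m : Sym2 V → V → ℕ) : Prop :=
  (∀ i j : V, G.Adj i j → m s(i, j) i + m s(i, j) j = Fintype.card V) ∧
  (∀ i : V, ∑ e ∈ G.edgeFinset.filter (fun e => i ∈ e), m e i ≤ G.edgeFinset.card)

namespace SimpleGraph

variable {V : Type} {G : SimpleGraph V}

/-- Hall's theorem for distributing `n` items on each edge to the endpoints of that edge, where
every vertex has `m` slots. -/
theorem exists_injective_edge_items_to_endpoint_slots [Fintype V] [DecidableEq V]
    [DecidableRel G.Adj] {d n m : ℕ} (hdeg : ∀ v, G.degree v ≤ d) (hm : 0 < m)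
    (hnm : d * n ≤ 2 * m) :
    ∃ f : ↥G.edgeSet × Fin n → V × Fin m, Function.Injective f ∧
      ∀ p, (f p).1 ∈ (p.1 : Sym2 V) := by
  let slots : ↥G.edgeSet × Fin n → Finset (V × Fin m) := fun p =>
    (p.1 : Sym2 V).toFinset ×ˢ Finset.univ
  obtain ⟨f, hf, hmem⟩ :=
    (Finset.all_card_le_biUnion_card_iff_exists_injective slots).1 fun S => by
      have hcount : S.card * (2 * m) ≤ (S.biUnion slots).card * (2 * m) := by
        refine Finset.card_mul_le_card_mul (fun p q => q ∈ slots p) (fun p hp => ?_)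
          (fun q _ => ?_)
        · have hcard : (slots p).card = 2 * m := by
            simp [slots, Finset.card_product,
              Sym2.card_toFinset_of_not_isDiag _ (G.not_isDiag_of_mem_edgeSet p.1.2)]
          rw [← hcard]
          refine Finset.card_le_card fun q hq => ?_
          exact Finset.mem_filter.2 ⟨Finset.mem_biUnion.2 ⟨p, hp, hq⟩, hq⟩
        · refine le_trans ?_ hnm
          calc _ ≤ (G.incidenceFinset q.1 ×ˢ (Finset.univ : Finset (Fin n))).card := by
                refine Finset.card_le_card_of_injOn (fun p => ((p.1 : Sym2 V), p.2)) ?_ ?_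
                · intro p hp
                  have hq := (Finset.mem_filter.1 hp).2
                  have hq' : q.1 ∈ (p.1 : Sym2 V) := by simpa [slots] using hq
                  simp [SimpleGraph.incidenceSet, hq']
                · rintro ⟨e, k⟩ _ ⟨e', k'⟩ _ h
                  simpa [Subtype.ext_iff] using h
            _ ≤ d * n := by
                rw [Finset.card_product, card_incidenceFinset_eq_degree, Finset.card_univ,
                  Fintype.card_fin]
                exact Nat.mul_le_mul_right _ (hdeg _)
      exact Nat.le_of_mul_le_mul_right hcount (by omega)
  exact ⟨f, hf, fun p => by simpa [slots] using hmem p⟩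

end SimpleGraph

section A1

variable {V : Type} {G : SimpleGraph V}

theorem A1_inter_A1 {i j : V} (h : G.Adj i j) :
    A1 G i ∩ A1 G j = {Sum.inr ⟨s(i, j), h⟩} := by
  ext s
  rcases s with k | e
  · have := h.ne
    simp only [Set.mem_inter_iff, Set.mem_singleton_iff, reduceCtorEq, iff_false, not_and]
    intro (hi : k = i) (hj : k = j)
    exact this (hi.symm.trans hj)
  · change (i ∈ (e : Sym2 V) ∧ j ∈ (e : Sym2 V)) ↔ _
    rw [Sym2.mem_and_mem_iff h.ne]
    simp [Subtype.ext_iff]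

variable [Fintype V] [DecidableEq V] [DecidableRel G.Adj] {M : Type*} [AddCommGroup M]

theorem sum_indicator_A1_add {i j : V} (h : G.Adj i j) (x : Src1 G → M) :
    ∑ s, (A1 G i).indicator x s + ∑ s, (A1 G j).indicator x s =
      ∑ s, (A1 G i ∪ A1 G j).indicator x s + x (Sum.inr ⟨s(i, j), h⟩) := by
  classical
  have hsingle : ∑ s, (A1 G i ∩ A1 G j).indicator x s = x (Sum.inr ⟨s(i, j), h⟩) := by
    rw [A1_inter_A1 h]
    simp [Set.indicator_apply, -Fintype.sum_sum_type]
  rw [← hsingle, ← Finset.sum_add_distrib, ← Finset.sum_add_distrib]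
  refine Finset.sum_congr rfl fun s _ => ?_
  exact (congrFun (Set.indicator_union_add_inter x (A1 G i) (A1 G j)) s).symm

theorem sum_indicator_A1_eq (x : Src1 G → M) (i : V) :
    ∑ s, (A1 G i).indicator x s =
      x (Sum.inl i) + ∑ e : ↥G.edgeSet, (A1 G i).indicator x (Sum.inr e) := by
  classical
  have hmem (j : V) : Sum.inl j ∈ A1 G i ↔ j = i := Iff.rfl
  simp [Fintype.sum_sum_type, Set.indicator_apply, hmem]

theorem eq_of_sum_indicator_A1_eq {x y : Src1 G → M}
    (hedge : ∀ e, x (Sum.inr e) = y (Sum.inr e))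
    (hsum : ∀ i, ∑ s, (A1 G i).indicator x s = ∑ s, (A1 G i).indicator y s) : x = y := by
  funext s
  rcases s with i | e
  · have h := hsum i
    rw [sum_indicator_A1_eq, sum_indicator_A1_eq] at h
    have hrest : ∑ e : ↥G.edgeSet, (A1 G i).indicator x (Sum.inr e) =
        ∑ e : ↥G.edgeSet, (A1 G i).indicator y (Sum.inr e) :=
      Finset.sum_congr rfl fun e _ => by simp only [Set.indicator, hedge e]
    rwa [hrest, add_left_inj] at h
  · exact hedge e

end A1

theorem sum_eq_sum_of_indicator {S M : Type*} [Fintype S] [AddCommMonoid M] {T : Set S}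
    {x y : S → M} (hT : ∑ s, T.indicator x s = ∑ s, T.indicator y s)
    (hTc : ∀ s ∉ T, x s = y s) : ∑ s, x s = ∑ s, y s := by
  have hsplit (z : S → M) : ∑ s, z s = ∑ s, T.indicator z s + ∑ s, Tᶜ.indicator z s := by
    rw [← Finset.sum_add_distrib]
    exact Finset.sum_congr rfl fun s _ => (congrFun (Set.indicator_self_add_compl T z) s).symm
  rw [hsplit x, hsplit y, hT]
  congr 1
  refine Finset.sum_congr rfl fun s _ => ?_
  by_cases hs : s ∈ T
  · simp [hs]
  · simp [hs, hTc s hs]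

theorem exists_eq_comp_of_forall_eq {X Y Z : Type*} [Nonempty Z] (g : X → Y) (f : X → Z)
    (h : ∀ x y, g x = g y → f x = f y) : ∃ ψ : Y → Z, ∀ x, ψ (g x) = f x := by
  obtain ⟨ψ, hψ⟩ := (Function.factorsThrough_iff f).1 (fun x y hxy => h x y hxy)
  exact ⟨ψ, fun x => (congrFun hψ x).symm⟩

section Codes

variable {V : Type} [Fintype V] [DecidableEq V] {G : SimpleGraph V} [DecidableRel G.Adj]
  {A : Type} [Field A] [Fintype A] {r l α : ℕ}
  {φ : ∀ i : V, (↥(A1 G i) → (Fin r → A)) → (Fin (α * l) → A)}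

/-- Recoverability of the sum from the encoded data, with no explicit decoders. -/
theorem IsCode1.of_forall_eq
    (hedge : ∀ (i j : V) (h : G.Adj i j) (x y : Src1 G → Fin r → A),
      φ i (fun a => x a.1) = φ i (fun a => y a.1) →
      φ j (fun a => x a.1) = φ j (fun a => y a.1) →
      x (Sum.inr ⟨s(i, j), h⟩) = y (Sum.inr ⟨s(i, j), h⟩))
    (hvert : ∀ (i : V) (x y : Src1 G → Fin r → A),
      φ i (fun a => x a.1) = φ i (fun a => y a.1) →
      ∑ s, (A1 G i).indicator x s = ∑ s, (A1 G i).indicator y s) :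
    IsCode1 G A r l α φ := by
  refine ⟨fun i => ?_, fun i j h => ?_, ?_⟩
  · obtain ⟨ψ, hψ⟩ := exists_eq_comp_of_forall_eq
      (fun x : Src1 G → Fin r → A =>
        (φ i (fun a => x a.1), fun a : ↥((A1 G i)ᶜ) => x a.1)) (fun x => ∑ s, x s)
      (fun x y hxy => by
        obtain ⟨h₁, h₂⟩ := Prod.mk.inj hxy
        exact sum_eq_sum_of_indicator (hvert i x y h₁) fun s hs => congrFun h₂ ⟨s, hs⟩)
    exact ⟨fun u w => ψ (u, w), hψ⟩
  · obtain ⟨ψ, hψ⟩ := exists_eq_comp_of_forall_eq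
      (fun x : Src1 G → Fin r → A => (φ i (fun a => x a.1), φ j (fun a => x a.1),
        fun a : ↥((A1 G i ∪ A1 G j)ᶜ) => x a.1)) (fun x => ∑ s, x s)
      (fun x y hxy => by
        obtain ⟨h₁, h₂⟩ := Prod.mk.inj hxy
        obtain ⟨h₂, h₃⟩ := Prod.mk.inj h₂
        refine sum_eq_sum_of_indicator ?_ fun s hs => congrFun h₃ ⟨s, hs⟩
        have hx := sum_indicator_A1_add h x
        rwa [hvert i x y h₁, hvert j x y h₂, sum_indicator_A1_add h y, hedge i j h x y h₁ h₂,
          add_left_inj, eq_comm] at hx)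
    exact ⟨fun u v w => ψ (u, v, w), hψ⟩
  · refine exists_eq_comp_of_forall_eq
      (fun (x : Src1 G → Fin r → A) i => φ i (fun a => x a.1)) (fun x => ∑ s, x s)
      fun x y hxy => ?_
    suffices x = y by rw [this]
    refine eq_of_sum_indicator_A1_eq ?_ fun i => hvert i x y (congrFun hxy i)
    rintro ⟨e, he⟩
    induction e using Sym2.ind with
    | _ i j => exact hedge i j he x y (congrFun hxy i) (congrFun hxy j)

theorem IsCode1.sum_indicator_eq (hφ : IsCode1 G A r l α φ) {i : V}
    {x y : Src1 G → Fin r → A} (h : φ i (fun a => x a.1) = φ i (fun a => y a.1)) :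
    ∑ s, (A1 G i).indicator x s = ∑ s, (A1 G i).indicator y s := by
  obtain ⟨ψ, hψ⟩ := hφ.1 i
  have hin (z : Src1 G → Fin r → A) :
      (fun a : ↥(A1 G i) => (A1 G i).indicator z a.1) = fun a => z a.1 :=
    funext fun a => Set.indicator_of_mem a.2 z
  have hout (z : Src1 G → Fin r → A) :
      (fun a : ↥((A1 G i)ᶜ) => (A1 G i).indicator z a.1) = fun _ => 0 :=
    funext fun a => Set.indicator_of_notMem a.2 z
  rw [← hψ, ← hψ, hin, hin, hout, hout, h]

theorem IsCode1.sum_indicator_union_eq (hφ : IsCode1 G A r l α φ) {i j : V} (hij : G.Adj i j)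
    {x y : Src1 G → Fin r → A} (hi : φ i (fun a => x a.1) = φ i (fun a => y a.1))
    (hj : φ j (fun a => x a.1) = φ j (fun a => y a.1)) :
    ∑ s, (A1 G i ∪ A1 G j).indicator x s = ∑ s, (A1 G i ∪ A1 G j).indicator y s := by
  obtain ⟨ψ, hψ⟩ := hφ.2.1 i j hij
  have hin₁ (z : Src1 G → Fin r → A) :
      (fun a : ↥(A1 G i) => (A1 G i ∪ A1 G j).indicator z a.1) = fun a => z a.1 :=
    funext fun a => Set.indicator_of_mem (Set.mem_union_left _ a.2) z
  have hin₂ (z : Src1 G → Fin r → A) :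
      (fun a : ↥(A1 G j) => (A1 G i ∪ A1 G j).indicator z a.1) = fun a => z a.1 :=
    funext fun a => Set.indicator_of_mem (Set.mem_union_right _ a.2) z
  have hout (z : Src1 G → Fin r → A) :
      (fun a : ↥((A1 G i ∪ A1 G j)ᶜ) => (A1 G i ∪ A1 G j).indicator z a.1) = fun _ => 0 :=
    funext fun a => Set.indicator_of_notMem a.2 z
  rw [← hψ, ← hψ, hin₁, hin₁, hin₂, hin₂, hout, hout, hi, hj]

/-- The bottleneck symbols of a Construction-1 code determine all the sources. -/
theorem IsCode1.injective (hφ : IsCode1 G A r l α φ) :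
    Function.Injective fun (x : Src1 G → Fin r → A) (i : V) => φ i (fun a => x a.1) := by
  intro x y hxy
  have hxy (i : V) : φ i (fun a => x a.1) = φ i (fun a => y a.1) := congrFun hxy i
  refine eq_of_sum_indicator_A1_eq ?_ fun i => hφ.sum_indicator_eq (hxy i)
  rintro ⟨e, he⟩
  induction e using Sym2.ind with
  | _ i j =>
    have h := sum_indicator_A1_add he x
    rwa [hφ.sum_indicator_eq (hxy i), hφ.sum_indicator_eq (hxy j),
      hφ.sum_indicator_union_eq he (hxy i) (hxy j), sum_indicator_A1_add he y,
      add_right_inj, eq_comm] at h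

theorem IsCode1.mul_card_le (hφ : IsCode1 G A r l α φ) :
    r * (Fintype.card V + G.edgeFinset.card) ≤ α * l * Fintype.card V := by
  have h := Fintype.card_le_of_injective _ hφ.injective
  simp only [Fintype.card_fun, Fintype.card_fin, Fintype.card_sum, ← pow_mul,
    ← SimpleGraph.edgeFinset_card] at h
  exact (Nat.pow_le_pow_iff_right Fintype.one_lt_card).1 h

/-- Each vertex transmits the sum of its sources together with a share of the symbols of its
incident edges, the shares covering all symbols of every edge. -/
theorem exists_isCode1_of_injective {m : ℕ} (hl : α * l = r + m)
    {f : ↥G.edgeSet × Fin r → V × Fin m} (hf : Function.Injective f)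
    (hmem : ∀ p, (f p).1 ∈ (p.1 : Sym2 V)) :
    ∃ φ : ∀ i : V, (↥(A1 G i) → (Fin r → A)) → (Fin (α * l) → A), IsCode1 G A r l α φ := by
  let ext (i : V) (u : ↥(A1 G i) → Fin r → A) : Src1 G → Fin r → A :=
    Function.extend Subtype.val u 0
  have hext (i : V) (x : Src1 G → Fin r → A) :
      ext i (fun a => x a.1) = (A1 G i).indicator x := by
    funext s
    by_cases hs : s ∈ A1 G i
    · rw [Set.indicator_of_mem hs]
      exact Subtype.val_injective.extend_apply (fun a : ↥(A1 G i) => x a.1) 0 ⟨s, hs⟩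
    · rw [Set.indicator_of_notMem hs]
      exact Function.extend_apply' _ _ _ fun ⟨a, ha⟩ => hs (ha ▸ a.2)
  let share (i : V) (u : ↥(A1 G i) → Fin r → A) (t : Fin m) : A :=
    Function.extend f (fun p => ext i u (Sum.inr p.1) p.2) 0 (i, t)
  have hshare (p : ↥G.edgeSet × Fin r) (x : Src1 G → Fin r → A) :
      share (f p).1 (fun a => x a.1) (f p).2 = x (Sum.inr p.1) p.2 := by
    have hp : Sum.inr p.1 ∈ A1 G (f p).1 := hmem p
    simp only [share, hf.extend_apply, hext, Set.indicator_of_mem hp]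
  let φ (i : V) (u : ↥(A1 G i) → Fin r → A) : Fin (α * l) → A :=
    Fin.append (∑ s, ext i u s) (share i u) ∘ Fin.cast hl
  have hφ {i : V} {x y : Src1 G → Fin r → A}
      (h : φ i (fun a => x a.1) = φ i (fun a => y a.1)) :
      ∑ s, (A1 G i).indicator x s = ∑ s, (A1 G i).indicator y s ∧
        share i (fun a => x a.1) = share i (fun a => y a.1) := by
    have h' := (finCongr hl).surjective.injective_comp_right h
    refine ⟨?_, funext fun t => ?_⟩
    · rw [← hext, ← hext]
      funext k
      simpa using congrFun h' (Fin.castAdd m k)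
    · simpa using congrFun h' (Fin.natAdd r t)
  refine ⟨φ, .of_forall_eq (fun i j hij x y hi hj => ?_) fun i x y h => (hφ h).1⟩
  funext k
  set p : ↥G.edgeSet × Fin r := (⟨s(i, j), hij⟩, k)
  have hp : share (f p).1 (fun a => x a.1) = share (f p).1 (fun a => y a.1) := by
    rcases Sym2.mem_iff.1 (hmem p) with h | h
    · rw [h]; exact (hφ hi).2
    · rw [h]; exact (hφ hj).2
  have := congrFun hp (f p).2
  rwa [hshare, hshare] at this

end Codes

/-- For a finite connected `d`-regular simple graph `G` on `b` vertices with `d ≥ 2`,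
any finite field `A` and integer `α ≥ 1`, the Construction-1 sum-network built from `G`
with bottleneck capacity `α` has capacity exactly `2α/(2+d)`: there is a Construction-1
`(αb, b(2+d)/2)`-code of capacity `α` (note `b(2+d)/2 = |Ṽ| + |Ẽ|` since `|Ẽ| = db/2`),
and every Construction-1 `(r,l)`-code of capacity `α` satisfies `r·(2+d) ≤ 2·l·α`. -/
theorem regular_graph_capacity {V : Type} [Fintype V] [DecidableEq V]
    (G : SimpleGraph V) [DecidableRel G.Adj] (hG : G.Connected) (d : ℕ) (hd : 2 ≤ d)
    (hreg : G.IsRegularOfDegree d) (b : ℕ) (hb : b = Fintype.card V)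
    (A : Type) [Field A] [Fintype A] (α : ℕ) (hα : 1 ≤ α) :
    (∃ φ : ∀ i : V, (↥(A1 G i) → (Fin (α * b) → A)) → (Fin (α * (b * (2 + d) / 2)) → A),
      IsCode1 G A (α * b) (b * (2 + d) / 2) α φ) ∧
    (∀ r l : ℕ, 0 < r → 0 < l →
      (∃ φ : ∀ i : V, (↥(A1 G i) → (Fin r → A)) → (Fin (α * l) → A),
        IsCode1 G A r l α φ) →
      r * (2 + d) ≤ 2 * (l * α)) := by
  subst hb
  have hpos : 0 < Fintype.card V := Fintype.card_pos_iff.2 hG.nonempty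
  have hE : d * Fintype.card V = 2 * G.edgeFinset.card := by
    rw [← G.sum_degrees_eq_twice_card_edges, Finset.sum_congr rfl fun v _ => hreg v]
    simp [mul_comm]
  constructor
  · have hl : Fintype.card V * (2 + d) / 2 = Fintype.card V + G.edgeFinset.card := by
      have : Fintype.card V * (2 + d) = 2 * (Fintype.card V + G.edgeFinset.card) := by
        linarith
      omega
    have hEpos : 0 < G.edgeFinset.card := by nlinarith
    obtain ⟨f, hf, hmem⟩ := G.exists_injective_edge_items_to_endpoint_slots
      (n := α * Fintype.card V) (m := α * G.edgeFinset.card) (fun v => (hreg v).le)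
      (Nat.mul_pos hα hEpos) (le_of_eq (by linear_combination α * hE))
    exact exists_isCode1_of_injective (by rw [hl, mul_add]) hf hmem
  · rintro r l - - ⟨φ, hφ⟩
    have h := hφ.mul_card_le
    refine Nat.le_of_mul_le_mul_right ?_ hpos
    calc r * (2 + d) * Fintype.card V
        = 2 * (r * (Fintype.card V + G.edgeFinset.card)) := by linear_combination r * hE
      _ ≤ 2 * (α * l * Fintype.card V) := Nat.mul_le_mul_left 2 h
      _ = 2 * (l * α) * Fintype.card V := by ring
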